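/- There exists a real number β₀ with 0.85 < β₀ < 1 such that the function F₂ is strictly decreasing on the interval (0, β₀] and strictly increasing on the interval [β₀, √2). -/

import Mathlib

open Real

/-- F₂(β) = 4β·log β + 2/β + 2(1−β)·log|1−β| − 2(1+β)·log(1+β). -/
noncomputable def F2 (β : ℝ) : ℝ :=
  4 * β * Real.log β + 2 / β + 2 * (1 - β) * Real.log |1 - β|
    - 2 * (1 + β) * Real.log (1 + β)

theorem F2_continuousOn : ContinuousOn F2 (Set.Ioi 0) := by
  have key : Continuous fun x : ℝ => 4 * (x * log x) + 2 * ((1 - x) * log (1 - x))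
      - 2 * ((1 + x) * log (1 + x)) := by
    have h := Real.continuous_mul_log
    exact ((h.const_mul 4).add ((h.comp (continuous_const.sub continuous_id)).const_mul 2)).sub
      ((h.comp (continuous_const.add continuous_id)).const_mul 2)
  have hdiv : ContinuousOn (fun x : ℝ => 2 / x) (Set.Ioi 0) :=
    continuousOn_const.div continuousOn_id fun x hx => ne_of_gt hx
  refine (key.continuousOn.add hdiv).congr fun x _ => ?_
  simp only [F2, log_abs, Pi.add_apply]
  ring

theorem hasDerivAt_F2 {β : ℝ} (h0 : 0 < β) (h1 : β ≠ 1) :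
    HasDerivAt F2 (-2 * (β⁻¹ ^ 2 + log (β⁻¹ ^ 2 - 1))) β := by
  have hβ : β ≠ 0 := h0.ne'
  have hsub : 1 - β ≠ 0 := sub_ne_zero.mpr h1.symm
  have hadd : 1 + β ≠ 0 := by positivity
  have e : F2 = fun x : ℝ => 4 * (x * log x) + 2 * x⁻¹ + 2 * ((1 - x) * log (1 - x))
      - 2 * ((1 + x) * log (1 + x)) := by
    ext x
    simp only [F2, log_abs]
    ring
  have hlog : log (β⁻¹ ^ 2 - 1) = log (1 - β) + log (1 + β) - 2 * log β := by
    have : β⁻¹ ^ 2 - 1 = (1 - β) * (1 + β) / β ^ 2 := by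
      field_simp
      ring
    rw [this, log_div (mul_ne_zero hsub hadd) (pow_ne_zero 2 hβ), log_mul hsub hadd, log_pow]
    norm_num
  have d1 := (hasDerivAt_mul_log hβ).const_mul 4
  have d2 := (hasDerivAt_inv hβ).const_mul 2
  have d3 := ((hasDerivAt_mul_log hsub).comp β ((hasDerivAt_id β).const_sub 1)).const_mul 2
  have d4 := ((hasDerivAt_mul_log hadd).comp β ((hasDerivAt_id β).const_add 1)).const_mul 2
  rw [e]
  refine (((d1.add d2).add d3).sub d4).congr_deriv ?_
  rw [hlog]
  field_simp
  ring

theorem exists_add_one_add_log_eq_zero :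
    ∃ s : ℝ, 0 < s ∧ s < 0.384 ∧ 1 + s + log s = 0 := by
  have hexp : exp (-1) < 0.384 := by
    rw [exp_neg, inv_lt_comm₀ (exp_pos 1) (by norm_num)]
    exact lt_of_le_of_lt (by norm_num) exp_one_gt_d9
  have hlt : exp (-2) < exp (-1) := exp_lt_exp.mpr (by norm_num)
  have hcont : ContinuousOn (fun s : ℝ => 1 + s + log s) (Set.Icc (exp (-2)) (exp (-1))) :=
    (continuousOn_const.add continuousOn_id).add
      (continuousOn_log.mono fun x hx => ((exp_pos _).trans_le hx.1).ne')
  obtain ⟨s, hs, hs0⟩ := intermediate_value_Icc hlt.le hcont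
    (show (0 : ℝ) ∈ _ by
      simp only [Set.mem_Icc, log_exp]
      constructor <;> linarith [exp_pos (-1)])
  exact ⟨s, (exp_pos _).trans_le hs.1, hs.2.trans_lt hexp, hs0⟩

theorem F2_monotonicity :
    ∃ β₀ : ℝ, 0.85 < β₀ ∧ β₀ < 1 ∧
      StrictAntiOn F2 (Set.Ioc 0 β₀) ∧ StrictMonoOn F2 (Set.Ico β₀ (Real.sqrt 2)) := by
  obtain ⟨s, hs0, hs1, hs⟩ := exists_add_one_add_log_eq_zero
  obtain ⟨b, hb0, hbs⟩ : ∃ b : ℝ, 0 < b ∧ b⁻¹ ^ 2 = 1 + s :=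
    ⟨(√(1 + s))⁻¹, by positivity, by rw [inv_inv, sq_sqrt (by positivity)]⟩
  have hmul : b ^ 2 * (1 + s) = 1 := by
    rw [← hbs, ← mul_pow, mul_inv_cancel₀ hb0.ne', one_pow]
  have hb1 : b < 1 := by
    by_contra! h
    have := one_le_pow₀ (n := 2) h
    nlinarith
  refine ⟨b, by norm_num at hs1 ⊢; nlinarith, hb1, ?_, ?_⟩
  · refine strictAntiOn_of_deriv_neg (convex_Ioc 0 b)
      (F2_continuousOn.mono fun x hx => hx.1) fun x hx => ?_
    rw [interior_Ioc] at hx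
    have hlt : b⁻¹ ^ 2 < x⁻¹ ^ 2 :=
      pow_lt_pow_left₀ (inv_strictAnti₀ hx.1 hx.2) (by positivity) two_ne_zero
    rw [(hasDerivAt_F2 hx.1 (hx.2.trans hb1).ne).deriv]
    have := log_lt_log hs0 (show s < x⁻¹ ^ 2 - 1 by linarith)
    linarith
  · have hleft : StrictMonoOn F2 (Set.Icc b 1) := by
      refine strictMonoOn_of_deriv_pos (convex_Icc b 1)
        (F2_continuousOn.mono fun x hx => hb0.trans_le hx.1) fun x hx => ?_
      rw [interior_Icc] at hx
      have hx0 : 0 < x := hb0.trans hx.1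
      have hlt : x⁻¹ ^ 2 < b⁻¹ ^ 2 :=
        pow_lt_pow_left₀ (inv_strictAnti₀ hb0 hx.1) (by positivity) two_ne_zero
      have hone : 1 < x⁻¹ ^ 2 := one_lt_pow₀ ((one_lt_inv₀ hx0).mpr hx.2) two_ne_zero
      rw [(hasDerivAt_F2 hx0 hx.2.ne).deriv]
      have := log_lt_log (sub_pos.mpr hone) (show x⁻¹ ^ 2 - 1 < s by linarith)
      linarith
    have hright : StrictMonoOn F2 (Set.Ici 1) := by
      refine strictMonoOn_of_deriv_pos (convex_Ici 1)
        (F2_continuousOn.mono fun x hx => Set.mem_Ioi.mpr (one_pos.trans_le hx)) fun x hx => ?_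
      rw [interior_Ici, Set.mem_Ioi] at hx
      have hx0 : 0 < x := one_pos.trans hx
      have hpos : 0 < x⁻¹ ^ 2 := by positivity
      have hone : x⁻¹ ^ 2 < 1 :=
        pow_lt_one₀ (by positivity) (inv_lt_one_of_one_lt₀ hx) two_ne_zero
      rw [(hasDerivAt_F2 hx0 hx.ne').deriv, ← log_neg_eq_log, neg_sub]
      have := log_lt_sub_one_of_pos (sub_pos.mpr hone) (by linarith)
      linarith
    refine (hleft.union hright (isGreatest_Icc hb1.le) isLeast_Ici).mono fun x hx => ?_
    exact (le_total x 1).imp (fun h => ⟨hx.1, h⟩) id
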